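/- arXiv:1809.03400 — 4 statements merged into one kernel-verified Lean document; each statement's English description precedes it below -/
import Mathlib

section
/- Let (Ω, 𝒜, P) be a probability space, G a type of groups, Z : Ω → G measurable, and Y, Ŷ : Ω → ℤ measurable random variables taking values in {0,1} (the true and predicted labels). Assume P(Z = z and Y = y) > 0 for every z ∈ G and y ∈ {0,1}. Then the following are equivalent: (i) [Rawlsian EOP with actual utility A = Ŷ, effort-based utility D = Y, and advantage U = Ŷ − Y] for all z, z' ∈ G, all y ∈ {0,1}, and all u ∈ ℤ, P(Ŷ − Y ≤ u | Z = z, Y = y) = P(Ŷ − Y ≤ u | Z = z', Y = y); (ii) [equality of odds] for all z, z' ∈ G and all y, ŷ ∈ {0,1}, P(Ŷ = ŷ | Z = z, Y = y) = P(Ŷ = ŷ | Z = z', Y = y). -/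
open MeasureTheory ProbabilityTheory

/-- Equality of odds as Rawlsian EOP: with actual utility `A = Ŷ`, effort-based
utility `D = Y`, and advantage `U = Ŷ - Y`, Rawlsian equality of opportunity is
equivalent to equality of odds for binary classification. -/
theorem equality_of_odds_iff_rawlsian_eop
    {Ω : Type*} [MeasurableSpace Ω] (P : Measure Ω) [IsProbabilityMeasure P]
    {G : Type*} [MeasurableSpace G]
    (Z : Ω → G) (Y Yhat : Ω → ℤ)
    (hZ : Measurable Z) (hY : Measurable Y) (hYhat : Measurable Yhat)
    (hY01 : ∀ ω, Y ω = 0 ∨ Y ω = 1)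
    (hYhat01 : ∀ ω, Yhat ω = 0 ∨ Yhat ω = 1)
    (hpos : ∀ (z : G) (y : ℤ), y = 0 ∨ y = 1 →
      0 < P ({ω | Z ω = z} ∩ {ω | Y ω = y})) :
    (∀ z z' : G, ∀ y : ℤ, (y = 0 ∨ y = 1) → ∀ u : ℤ,
        (P[|{ω | Z ω = z} ∩ {ω | Y ω = y}]) {ω | Yhat ω - Y ω ≤ u}
          = (P[|{ω | Z ω = z'} ∩ {ω | Y ω = y}]) {ω | Yhat ω - Y ω ≤ u})
      ↔
    (∀ z z' : G, ∀ y yhat : ℤ, (y = 0 ∨ y = 1) → (yhat = 0 ∨ yhat = 1) →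
        (P[|{ω | Z ω = z} ∩ {ω | Y ω = y}]) {ω | Yhat ω = yhat}
          = (P[|{ω | Z ω = z'} ∩ {ω | Y ω = y}]) {ω | Yhat ω = yhat}) := by
  have hprob : ∀ (z : G) (y : ℤ), (y = 0 ∨ y = 1) →
      IsProbabilityMeasure (P[|{ω | Z ω = z} ∩ {ω | Y ω = y}]) := fun z y hy =>
    cond_isProbabilityMeasure (hpos z y hy).ne'
  have hm0 : ∀ k : ℤ, MeasurableSet {ω | Yhat ω = k} := fun k =>
    hYhat (measurableSet_singleton k)
  have hmle : ∀ k : ℤ, MeasurableSet {ω | Yhat ω ≤ k} := fun k => hYhat measurableSet_Iic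
  have hmd : ∀ k : ℤ, MeasurableSet {ω | Yhat ω - Y ω ≤ k} := fun k =>
    (hYhat.sub hY) measurableSet_Iic
  have key : ∀ (z : G) (y u : ℤ),
      (P[|{ω | Z ω = z} ∩ {ω | Y ω = y}]) {ω | Yhat ω - Y ω ≤ u}
        = (P[|{ω | Z ω = z} ∩ {ω | Y ω = y}]) {ω | Yhat ω ≤ u + y} := by
    intro z y u
    simp only [ProbabilityTheory.cond, Measure.smul_apply]
    rw [Measure.restrict_apply (hmd u), Measure.restrict_apply (hmle _)]
    congr 2
    ext ω
    simp only [Set.mem_inter_iff, Set.mem_ofPred_eq]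
    constructor
    · rintro ⟨h1, h2, h3⟩
      exact ⟨by omega, h2, h3⟩
    · rintro ⟨h1, h2, h3⟩
      exact ⟨by omega, h2, h3⟩
  have e0 : {ω | Yhat ω ≤ 0} = {ω | Yhat ω = 0} := by
    ext ω
    have := hYhat01 ω
    simp only [Set.mem_ofPred_eq]
    omega
  have e1 : {ω | Yhat ω = 1} = {ω | Yhat ω = 0}ᶜ := by
    ext ω
    have := hYhat01 ω
    simp only [Set.mem_ofPred_eq, Set.mem_compl_iff]
    omega
  constructor
  · intro h z z' y yhat hy hyhat
    have := hprob z y hy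
    have := hprob z' y hy
    have h0 := h z z' y hy (-y)
    rw [key, key, neg_add_cancel, e0] at h0
    rcases hyhat with rfl | rfl
    · exact h0
    · rw [e1, prob_compl_eq_one_sub (hm0 0), prob_compl_eq_one_sub (hm0 0), h0]
  · intro h z z' y hy u
    have := hprob z y hy
    have := hprob z' y hy
    rw [key, key]
    rcases lt_trichotomy (u + y) 0 with hk | hk | hk
    · have : {ω | Yhat ω ≤ u + y} = ∅ := by
        ext ω
        have := hYhat01 ω
        simp only [Set.mem_ofPred_eq, Set.mem_empty_iff_false, iff_false]
        omega
      rw [this, measure_empty, measure_empty]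
    · rw [hk, e0]
      exact h z z' y 0 hy (Or.inl rfl)
    · have : {ω | Yhat ω ≤ u + y} = Set.univ := by
        ext ω
        have := hYhat01 ω
        simp only [Set.mem_ofPred_eq, Set.mem_univ, iff_true]
        omega
      rw [this, measure_univ, measure_univ]
end

section
/- Let (Ω, 𝒜, P) be a probability space, G a type of groups, Z : Ω → G measurable, and Ŷ : Ω → ℤ a measurable random variable taking values in {0,1} (the predicted label). Assume P(Z = z) > 0 for every z ∈ G. Then the following are equivalent: (i) [Rawlsian EOP with actual utility A = Ŷ, constant effort-based utility D = 1, and advantage U = Ŷ − 1] for all z, z' ∈ G and all u ∈ ℤ, P(Ŷ − 1 ≤ u | Z = z) = P(Ŷ − 1 ≤ u | Z = z'); (ii) [statistical parity] for all z, z' ∈ G and all ŷ ∈ {0,1}, P(Ŷ = ŷ | Z = z) = P(Ŷ = ŷ | Z = z'). -/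
open MeasureTheory ProbabilityTheory

/-- Statistical parity as Rawlsian EOP: with actual utility `A = Ŷ`, constant
effort-based utility `D = 1`, and advantage `U = Ŷ - 1`, Rawlsian equality of
opportunity is equivalent to statistical parity for binary classification. -/
theorem statistical_parity_iff_rawlsian_eop
    {Ω : Type*} [MeasurableSpace Ω] (P : Measure Ω) [IsProbabilityMeasure P]
    {G : Type*} [MeasurableSpace G]
    (Z : Ω → G) (Yhat : Ω → ℤ)
    (hZ : Measurable Z) (hYhat : Measurable Yhat)
    (hYhat01 : ∀ ω, Yhat ω = 0 ∨ Yhat ω = 1)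
    (hpos : ∀ z : G, 0 < P {ω | Z ω = z}) :
    (∀ z z' : G, ∀ u : ℤ,
        (P[|{ω | Z ω = z}]) {ω | Yhat ω - 1 ≤ u}
          = (P[|{ω | Z ω = z'}]) {ω | Yhat ω - 1 ≤ u})
      ↔
    (∀ z z' : G, ∀ yhat : ℤ, (yhat = 0 ∨ yhat = 1) →
        (P[|{ω | Z ω = z}]) {ω | Yhat ω = yhat}
          = (P[|{ω | Z ω = z'}]) {ω | Yhat ω = yhat}) := by
  have hprob : ∀ z : G, IsProbabilityMeasure (P[|{ω | Z ω = z}]) := fun z =>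
    cond_isProbabilityMeasure (hpos z).ne'
  have h0 : {ω | Yhat ω - 1 ≤ -1} = {ω | Yhat ω = 0} := by
    ext ω
    simp only [Set.mem_ofPred_eq]
    rcases hYhat01 ω with h | h <;> omega
  have h1 : {ω | Yhat ω = 1} = {ω | Yhat ω = 0}ᶜ := by
    ext ω
    simp only [Set.mem_ofPred_eq, Set.mem_compl_iff]
    rcases hYhat01 ω with h | h <;> omega
  have hm : MeasurableSet {ω | Yhat ω = 0} := hYhat (measurableSet_singleton 0)
  constructor
  · intro H z z' y hy
    have := hprob z
    have := hprob z'
    have e := H z z' (-1)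
    rw [h0] at e
    rcases hy with rfl | rfl
    · exact e
    · rw [h1, prob_compl_eq_one_sub hm, prob_compl_eq_one_sub hm, e]
  · intro H z z' u
    have := hprob z
    have := hprob z'
    rcases lt_trichotomy u (-1) with hu | rfl | hu
    · have : {ω | Yhat ω - 1 ≤ u} = ∅ := by
        ext ω
        simp only [Set.mem_ofPred_eq, Set.mem_empty_iff_false, iff_false]
        rcases hYhat01 ω with h | h <;> omega
      rw [this, measure_empty, measure_empty]
    · rw [h0]
      exact H z z' 0 (Or.inl rfl)
    · have : {ω | Yhat ω - 1 ≤ u} = Set.univ := by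
        ext ω
        simp only [Set.mem_ofPred_eq, Set.mem_univ, iff_true]
        rcases hYhat01 ω with h | h <;> omega
      rw [this, measure_univ, measure_univ]
end

section
/- Let (Ω, 𝒜, P) be a probability space, G a type of groups, Z : Ω → G measurable, and Y, Ŷ : Ω → ℤ measurable random variables taking values in {0,1} (the true and predicted labels). Assume P(Z = z) > 0 for every z ∈ G. Then the following are equivalent: (i) [Rawlsian EOP with actual utility A = (Ŷ − Y)², constant effort-based utility D = 0, and advantage U = (Ŷ − Y)²] for all z, z' ∈ G and all u ∈ ℤ, P((Ŷ − Y)² ≤ u | Z = z) = P((Ŷ − Y)² ≤ u | Z = z'); (ii) [equality of accuracy] for all z, z' ∈ G, E[(Ŷ − Y)² | Z = z] = E[(Ŷ − Y)² | Z = z']. -/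
open MeasureTheory ProbabilityTheory

/-- Equality of accuracy as Rawlsian EOP: with actual utility `A = (Ŷ - Y)²`,
constant effort-based utility `D = 0`, and advantage `U = (Ŷ - Y)²`, Rawlsian
equality of opportunity is equivalent to equality of accuracy across groups. -/
theorem equality_of_accuracy_iff_rawlsian_eop
    {Ω : Type*} [MeasurableSpace Ω] (P : Measure Ω) [IsProbabilityMeasure P]
    {G : Type*} [MeasurableSpace G]
    (Z : Ω → G) (Y Yhat : Ω → ℤ)
    (hZ : Measurable Z) (hY : Measurable Y) (hYhat : Measurable Yhat)
    (hY01 : ∀ ω, Y ω = 0 ∨ Y ω = 1)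
    (hYhat01 : ∀ ω, Yhat ω = 0 ∨ Yhat ω = 1)
    (hpos : ∀ z : G, 0 < P {ω | Z ω = z}) :
    (∀ z z' : G, ∀ u : ℤ,
        (P[|{ω | Z ω = z}]) {ω | (Yhat ω - Y ω) ^ 2 ≤ u}
          = (P[|{ω | Z ω = z'}]) {ω | (Yhat ω - Y ω) ^ 2 ≤ u})
      ↔
    (∀ z z' : G,
        (∫ ω, (((Yhat ω - Y ω) ^ 2 : ℤ) : ℝ) ∂(P[|{ω | Z ω = z}]))
          = ∫ ω, (((Yhat ω - Y ω) ^ 2 : ℤ) : ℝ) ∂(P[|{ω | Z ω = z'}])) := by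
  have hsq : ∀ ω, (Yhat ω - Y ω) ^ 2 = 0 ∨ (Yhat ω - Y ω) ^ 2 = 1 := by
    intro ω
    rcases hY01 ω with h | h <;> rcases hYhat01 ω with h' | h' <;> simp [h, h']
  have hE : MeasurableSet {ω | (Yhat ω - Y ω) ^ 2 ≤ 0} :=
    measurableSet_le ((hYhat.sub hY).pow_const 2) measurable_const
  have hprob : ∀ z, IsProbabilityMeasure (P[|{ω | Z ω = z}]) := fun z =>
    cond_isProbabilityMeasure (hpos z).ne'
  have hint : ∀ z, (∫ ω, (((Yhat ω - Y ω) ^ 2 : ℤ) : ℝ) ∂(P[|{ω | Z ω = z}]))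
      = 1 - (P[|{ω | Z ω = z}]).real {ω | (Yhat ω - Y ω) ^ 2 ≤ 0} := by
    intro z
    have := hprob z
    rw [← probReal_compl_eq_one_sub hE, ← integral_indicator_one hE.compl]
    congr 1
    funext ω
    rcases hsq ω with h | h <;> simp only [Set.indicator, Set.mem_compl_iff, Set.mem_setOf_eq, h] <;>
      simp
  constructor
  · intro h z z'
    rw [hint, hint, measureReal_def, measureReal_def, h z z' 0]
  · intro h z z' u
    have := hprob z
    have := hprob z'
    have h0 := h z z'
    rw [hint, hint] at h0
    have h1 : (P[|{ω | Z ω = z}]).real {ω | (Yhat ω - Y ω) ^ 2 ≤ 0}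
      = (P[|{ω | Z ω = z'}]).real {ω | (Yhat ω - Y ω) ^ 2 ≤ 0} := by linarith
    rw [measureReal_def, measureReal_def,
      ENNReal.toReal_eq_toReal_iff' (measure_ne_top _ _) (measure_ne_top _ _)] at h1
    rcases lt_trichotomy u 0 with hu | hu | hu
    · have : {ω | (Yhat ω - Y ω) ^ 2 ≤ u} = ∅ := by
        ext ω
        have := hsq ω
        simp only [Set.mem_setOf_eq, Set.mem_empty_iff_false, iff_false]
        omega
      simp only [this, measure_empty]
    · subst hu
      exact h1
    · have : {ω | (Yhat ω - Y ω) ^ 2 ≤ u} = Set.univ := by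
        ext ω
        have := hsq ω
        simp only [Set.mem_setOf_eq, Set.mem_univ, iff_true]
        omega
      simp only [this, measure_univ]
end

section
/- Let (Ω, 𝒜, P) be a probability space, G a type of groups, Z : Ω → G measurable, and Y, Ŷ : Ω → ℤ measurable random variables taking values in {0,1} (the true and predicted labels). Assume P(Z = z and Ŷ = ŷ) > 0 for every z ∈ G and ŷ ∈ {0,1}. Then the following are equivalent: (i) [luck egalitarian EOP with actual utility A = Y, effort-based utility D = Ŷ, and advantage U = Y − Ŷ] for all z, z' ∈ G, all ŷ ∈ {0,1}, and all u ∈ ℤ, P(Y − Ŷ ≤ u | Z = z, Ŷ = ŷ) = P(Y − Ŷ ≤ u | Z = z', Ŷ = ŷ); (ii) [predictive value parity] for all z, z' ∈ G and all y, ŷ ∈ {0,1}, P(Y = y | Z = z, Ŷ = ŷ) = P(Y = y | Z = z', Ŷ = ŷ). -/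
open MeasureTheory ProbabilityTheory

/-- Predictive value parity as luck egalitarian EOP: with actual utility `A = Y`,
effort-based utility `D = Ŷ`, and advantage `U = Y - Ŷ`, luck egalitarian
equality of opportunity is equivalent to predictive value parity for binary
classification. -/
theorem predictive_value_parity_iff_egalitarian_eop
    {Ω : Type*} [MeasurableSpace Ω] (P : Measure Ω) [IsProbabilityMeasure P]
    {G : Type*} [MeasurableSpace G]
    (Z : Ω → G) (Y Yhat : Ω → ℤ)
    (hZ : Measurable Z) (hY : Measurable Y) (hYhat : Measurable Yhat)
    (hY01 : ∀ ω, Y ω = 0 ∨ Y ω = 1)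
    (hYhat01 : ∀ ω, Yhat ω = 0 ∨ Yhat ω = 1)
    (hpos : ∀ (z : G) (yhat : ℤ), yhat = 0 ∨ yhat = 1 →
      0 < P ({ω | Z ω = z} ∩ {ω | Yhat ω = yhat})) :
    (∀ z z' : G, ∀ yhat : ℤ, (yhat = 0 ∨ yhat = 1) → ∀ u : ℤ,
        (P[|{ω | Z ω = z} ∩ {ω | Yhat ω = yhat}]) {ω | Y ω - Yhat ω ≤ u}
          = (P[|{ω | Z ω = z'} ∩ {ω | Yhat ω = yhat}]) {ω | Y ω - Yhat ω ≤ u})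
      ↔
    (∀ z z' : G, ∀ y yhat : ℤ, (y = 0 ∨ y = 1) → (yhat = 0 ∨ yhat = 1) →
        (P[|{ω | Z ω = z} ∩ {ω | Yhat ω = yhat}]) {ω | Y ω = y}
          = (P[|{ω | Z ω = z'} ∩ {ω | Yhat ω = yhat}]) {ω | Y ω = y}) := by
  have prob : ∀ z yhat, (yhat = 0 ∨ yhat = 1) →
      IsProbabilityMeasure (P[|{ω | Z ω = z} ∩ {ω | Yhat ω = yhat}]) :=
    fun z yhat h => cond_isProbabilityMeasure (hpos z yhat h).ne'
  have key : ∀ z yhat (u : ℤ),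
      (P[|{ω | Z ω = z} ∩ {ω | Yhat ω = yhat}]) {ω | Y ω - Yhat ω ≤ u}
        = (P[|{ω | Z ω = z} ∩ {ω | Yhat ω = yhat}]) {ω | Y ω ≤ u + yhat} := by
    intro z yhat u
    have m1 : MeasurableSet {ω | Y ω - Yhat ω ≤ u} :=
      measurableSet_le (hY.sub hYhat) measurable_const
    have m2 : MeasurableSet {ω | Y ω ≤ u + yhat} := measurableSet_le hY measurable_const
    rw [ProbabilityTheory.cond, Measure.smul_apply, Measure.smul_apply,
      Measure.restrict_apply m1, Measure.restrict_apply m2]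
    congr 2
    ext ω
    simp only [Set.mem_inter_iff, Set.mem_ofPred_eq]
    constructor
    · rintro ⟨h, h1, h2⟩
      exact ⟨by omega, h1, h2⟩
    · rintro ⟨h, h1, h2⟩
      exact ⟨by omega, h1, h2⟩
  have e0 : {ω | Y ω ≤ 0} = {ω | Y ω = 0} := by
    ext ω
    have := hY01 ω
    simp only [Set.mem_ofPred_eq]
    omega
  have e1 : {ω | Y ω = 1} = {ω | Y ω = 0}ᶜ := by
    ext ω
    have := hY01 ω
    simp only [Set.mem_ofPred_eq, Set.mem_compl_iff]
    omega
  have m0 : MeasurableSet {ω | Y ω = 0} := measurableSet_eq_fun hY measurable_const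
  constructor
  · intro H z z' y yhat hy hyh
    have := prob z yhat hyh
    have := prob z' yhat hyh
    have h0 := H z z' yhat hyh (-yhat)
    rw [key, key, neg_add_cancel, e0] at h0
    rcases hy with rfl | rfl
    · exact h0
    · rw [e1, prob_compl_eq_one_sub m0, prob_compl_eq_one_sub m0, h0]
  · intro H z z' yhat hyh u
    have := prob z yhat hyh
    have := prob z' yhat hyh
    rw [key, key]
    generalize u + yhat = k
    rcases lt_trichotomy k 0 with hk | rfl | hk
    · have : {ω | Y ω ≤ k} = ∅ := by
        ext ω
        have := hY01 ω
        simp only [Set.mem_ofPred_eq, Set.mem_empty_iff_false, iff_false, not_le]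
        omega
      rw [this, measure_empty, measure_empty]
    · rw [e0]
      exact H z z' 0 yhat (Or.inl rfl) hyh
    · have : {ω | Y ω ≤ k} = Set.univ := by
        ext ω
        have := hY01 ω
        simp only [Set.mem_ofPred_eq, Set.mem_univ, iff_true]
        omega
      rw [this, measure_univ, measure_univ]
end
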